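/- Let D be a bounded domain in ℝⁿ, n ≥ 2, that is locally connected at every point of its boundary. Then for any two pairs of distinct points a ∈ D, b ∈ cl(D) and c ∈ D, d ∈ cl(D) with {a,b} ∩ {c,d} = ∅, there exist paths γ₁, γ₂ : [0,1] → cl(D) with disjoint images such that γᵢ(t) ∈ D for all t ∈ (0,1), γ₁(0) = a, γ₁(1) = b, γ₂(0) = c, γ₂(1) = d. -/

import Mathlib

open Set

/-- A domain `D` is locally connected at a boundary point `x₀` if every neighborhood
of `x₀` contains a neighborhood `V` of `x₀` such that `V ∩ D` is connected. -/
def LocallyConnectedAtBoundaryPoint {n : ℕ} (D : Set (EuclideanSpace ℝ (Fin n)))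
    (x₀ : EuclideanSpace ℝ (Fin n)) : Prop :=
  ∀ U ∈ nhds x₀, ∃ V ∈ nhds x₀, V ⊆ U ∧ IsConnected (V ∩ D)

open Filter Topology Metric

/-- Removing a point from an open preconnected set in dimension at least two leaves it
preconnected. -/
theorem IsPreconnected.diff_singleton_of_one_lt_rank {E : Type*} [NormedAddCommGroup E]
    [InnerProductSpace ℝ E] (hE : 1 < Module.rank ℝ E) {s : Set E} (hs : IsPreconnected s)
    (ho : IsOpen s) (p : E) : IsPreconnected (s \ {p}) := by
  by_cases hp : p ∈ s
  swap
  · rwa [sdiff_singleton_eq_self hp]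
  obtain ⟨r, hr, hrs⟩ := Metric.isOpen_iff.1 ho p hp
  have hball : IsPreconnected (ball p r \ {p}) := by
    let e := OpenPartialHomeomorph.univBall p r
    have hsource : e.source = univ := OpenPartialHomeomorph.univBall_source p r
    have htarget : e.target = ball p r := OpenPartialHomeomorph.univBall_target p hr
    have hzero : e 0 = p := OpenPartialHomeomorph.univBall_apply_zero p r
    have himage : e '' {0}ᶜ = ball p r \ {p} := by
      rw [← htarget, ← hzero, ← e.image_source_eq_target, hsource, compl_eq_univ_sdiff,
        InjOn.image_sdiff_subset (hsource ▸ e.injOn) (subset_univ _), image_singleton]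
    rw [← himage]
    exact (isConnected_compl_singleton_of_one_lt_rank hE 0).isPreconnected.image _
      (OpenPartialHomeomorph.continuous_univBall p r).continuousOn
  have key : ∀ u v : Set E, IsOpen u → IsOpen v → s \ {p} ⊆ u ∪ v →
      s \ {p} ∩ (u ∩ v) = ∅ → ball p r \ {p} ⊆ u → s \ {p} ⊆ u := by
    intro u v hu' hv hcover hdisj hu
    have hopen : IsOpen (s \ {p}) := ho.sdiff isClosed_singleton
    have hsub := isPreconnected_iff_subset_of_disjoint.1 hs (u ∩ (s \ {p}) ∪ ball p r)
      (v ∩ (s \ {p})) ((hu'.inter hopen).union isOpen_ball) (hv.inter hopen) ?_ ?_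
    · rcases hsub with h | h
      · rintro x ⟨hx, hxp⟩
        rcases h hx with h | h
        · exact h.1
        · exact hu ⟨h, hxp⟩
      · exact absurd rfl (h hp).2.2
    · intro x hx
      by_cases hxp : x = p
      · exact Or.inl (Or.inr (hxp ▸ mem_ball_self hr))
      · rcases hcover ⟨hx, hxp⟩ with h | h
        · exact Or.inl (Or.inl ⟨h, hx, hxp⟩)
        · exact Or.inr ⟨h, hx, hxp⟩
    · refine eq_empty_of_forall_notMem ?_
      rintro x ⟨-, h, hxv, hxs⟩
      refine (hdisj ▸ notMem_empty x) ⟨hxs, ?_, hxv⟩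
      rcases h with h | h
      · exact h.1
      · exact hu ⟨h, hxs.2⟩
  refine isPreconnected_iff_subset_of_disjoint.2 fun u v hu hv hcover hdisj => ?_
  have hbs : ball p r \ {p} ⊆ s \ {p} := sdiff_subset_sdiff_left hrs
  rcases isPreconnected_iff_subset_of_disjoint.1 hball u v hu hv (hbs.trans hcover)
    (subset_empty_iff.1 (hdisj ▸ inter_subset_inter_left _ hbs)) with h | h
  · exact Or.inl (key u v hu hv hcover hdisj h)
  · exact Or.inr (key v u hv hu (union_comm u v ▸ hcover) (inter_comm u v ▸ hdisj) h)

/-- A homeomorphism supported in a ball that moves the center to a prescribed point of the ball. -/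
theorem exists_homeomorph_apply_center_eq {E : Type*} [NormedAddCommGroup E] [NormedSpace ℝ E]
    [CompleteSpace E] {x y : E} {r : ℝ} (hy : y ∈ ball x r) :
    ∃ h : E ≃ₜ E, h x = y ∧ ∀ z ∉ ball x r, h z = z := by
  have hr : 0 < r := pos_of_mem_ball hy
  let f : E → E := fun z => z + (max 0 (r - dist z x) / r) • (y - x)
  have hlip : ∀ z w, |max 0 (r - dist z x) - max 0 (r - dist w x)| ≤ ‖z - w‖ := by
    intro z w
    refine (abs_max_sub_max_le_max _ _ _ _).trans ?_
    rw [sub_self, abs_zero, max_eq_right (abs_nonneg _), ← dist_eq_norm, sub_sub_sub_cancel_left,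
      dist_comm z w]
    exact abs_dist_sub_le w z x
  have happrox : ApproximatesLinearOn f (ContinuousLinearEquiv.refl ℝ E : E →L[ℝ] E) univ
      (‖y - x‖₊ / r.toNNReal) := by
    intro z _ w _
    have : f z - f w - (z - w) =
        ((max 0 (r - dist z x) - max 0 (r - dist w x)) / r) • (y - x) := by
      simp only [f, sub_div, sub_smul]; abel
    simp only [ContinuousLinearEquiv.coe_refl, ContinuousLinearMap.id_apply, this, norm_smul,
      norm_div, Real.norm_eq_abs, abs_of_pos hr, NNReal.coe_div, coe_nnnorm,
      Real.coe_toNNReal _ hr.le]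
    calc _ ≤ ‖z - w‖ / r * ‖y - x‖ := by gcongr; exact hlip z w
      _ = _ := by ring
  have hc : Subsingleton E ∨ ‖y - x‖₊ / r.toNNReal <
      ‖((ContinuousLinearEquiv.refl ℝ E).symm : E →L[ℝ] E)‖₊⁻¹ := by
    rcases subsingleton_or_nontrivial E with hE | hE
    · exact Or.inl hE
    · right
      have hone : ‖((ContinuousLinearEquiv.refl ℝ E).symm : E →L[ℝ] E)‖₊ = 1 := by
        ext; exact ContinuousLinearMap.norm_id
      rw [hone, inv_one, ← NNReal.coe_lt_coe]
      simpa [hr.le, div_lt_one hr, ← dist_eq_norm] using hy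
  refine ⟨happrox.toHomeomorph f hc, ?_, fun z hz => ?_⟩
  · change f x = y
    simp [f, hr.le, hr.ne']
  · change f z = z
    have : r - dist z x ≤ 0 := by simpa using hz
    simp [f, max_eq_left this]

/-- Homeomorphisms supported in an open preconnected set act transitively on it. -/
theorem IsPreconnected.exists_homeomorph_apply_eq {E : Type*} [NormedAddCommGroup E]
    [NormedSpace ℝ E] [CompleteSpace E] {s : Set E} (hs : IsPreconnected s) (ho : IsOpen s)
    {x y : E} (hx : x ∈ s) (hy : y ∈ s) :
    ∃ h : E ≃ₜ E, h x = y ∧ ∀ z ∉ s, h z = z := by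
  refine hs.induction₂ (fun x y => ∃ h : E ≃ₜ E, h x = y ∧ ∀ z ∉ s, h z = z) ?_ ?_ ?_ hx hy
  · intro x hx
    obtain ⟨r, hr, hrs⟩ := Metric.isOpen_iff.1 ho x hx
    filter_upwards [mem_nhdsWithin_of_mem_nhds (ball_mem_nhds x hr)] with y hy
    obtain ⟨h, hxy, hfix⟩ := exists_homeomorph_apply_center_eq hy
    exact ⟨h, hxy, fun z hz => hfix z fun hz' => hz (hrs hz')⟩
  · rintro x y z - - - ⟨g, rfl, hg⟩ ⟨h, rfl, hh⟩
    exact ⟨g.trans h, rfl, fun w hw => by simp [hg w hw, hh w hw]⟩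
  · rintro x y - - ⟨g, rfl, hg⟩
    exact ⟨g.symm, by simp, fun w hw => by rw [Homeomorph.symm_apply_eq, hg w hw]⟩

/-- Countably many paths, each starting where the previous one ends, concatenate to a continuous
map on the half-line. -/
theorem exists_continuous_concat {X : Type*} [TopologicalSpace X] {x : ℕ → X}
    (p : ∀ k, Path (x k) (x (k + 1))) :
    ∃ f : ℝ → X, Continuous f ∧ ∀ t, f t ∈ range (p ⌊t⌋₊) := by
  let f : ℝ → X := fun t => (p ⌊t⌋₊).extend (t - ⌊t⌋₊)
  have hfloor : ∀ k t, ⌊t⌋₊ = k → f t = (p k).extend (t - k) := by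
    rintro _ t rfl
    rfl
  have hpiece : ∀ k : ℕ, EqOn f (fun t => (p k).extend (t - k)) (Icc k (k + 1)) := by
    rintro k t ⟨hkt, htk⟩
    rcases htk.lt_or_eq with h | rfl
    · exact hfloor k t ((Nat.floor_eq_iff (k.cast_nonneg.trans hkt)).2 ⟨hkt, h⟩)
    · have : ⌊(k : ℝ) + 1⌋₊ = k + 1 := by exact_mod_cast Nat.floor_natCast (k + 1)
      rw [hfloor _ _ this]
      simp
  have hcont : ∀ k : ℕ, ContinuousOn f (Iic (k : ℝ)) := by
    intro k
    induction k with
    | zero =>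
      refine (continuousOn_const (c := x 0)).congr fun t ht => ?_
      have ht : t ≤ 0 := by simpa using ht
      rw [hfloor 0 t (Nat.floor_of_nonpos ht)]
      simpa using (p 0).extend_of_le_zero ht
    | succ k ih =>
      have hk : (k : ℝ) ≤ k + 1 := by linarith
      rw [Nat.cast_succ, ← Iic_union_Icc_eq_Iic hk]
      refine ih.union_of_isClosed (ContinuousOn.congr ?_ (hpiece k)) isClosed_Iic isClosed_Icc
      exact ((p k).continuous_extend.comp (continuous_id.sub continuous_const)).continuousOn
  refine ⟨f, continuous_iff_continuousAt.2 fun t => ?_, fun t => ?_⟩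
  · obtain ⟨k, hk⟩ := exists_nat_gt t
    exact (hcont k).continuousAt (Iic_mem_nhds hk)
  · rw [← (p ⌊t⌋₊).extend_range]
    exact mem_range_self _

/-- A boundary point at which `D` is locally connected is accessible from `D` by a path that stays
in a prescribed neighborhood. -/
theorem LocallyConnectedAtBoundaryPoint.exists_access_path {n : ℕ}
    {D : Set (EuclideanSpace ℝ (Fin n))} (hD : IsOpen D) {b : EuclideanSpace ℝ (Fin n)}
    (hb : b ∈ closure D) (hlc : LocallyConnectedAtBoundaryPoint D b)
    {U : Set (EuclideanSpace ℝ (Fin n))} (hU : U ∈ 𝓝 b) :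
    ∃ β : ℝ → EuclideanSpace ℝ (Fin n), ContinuousOn β (Icc 0 1) ∧ β 1 = b ∧
      ∀ t ∈ Ico (0 : ℝ) 1, β t ∈ U ∩ D := by
  obtain ⟨r, hr, hrU⟩ := Metric.mem_nhds_iff.1 hU
  let ρ : ℕ → ℝ := fun k => r / (k + 1)
  have hρ : ∀ k, 0 < ρ k := fun k => by positivity
  choose V hV hVρ hVD using fun k => hlc _ (ball_mem_nhds b (hρ k))
  have hx : ∀ k, ∃ x, x ∈ V k ∩ V (k - 1) ∩ D := fun k =>
    mem_closure_iff_nhds.1 hb _ (inter_mem (hV k) (hV (k - 1)))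
  choose x hx using hx
  have hjoin : ∀ k, JoinedIn (ball b (ρ k) ∩ D) (x k) (x (k + 1)) := by
    intro k
    have hxk : x k ∈ V k ∩ D := ⟨(hx k).1.1, (hx k).2⟩
    have hxk' : x (k + 1) ∈ V k ∩ D := ⟨(hx (k + 1)).1.2, (hx (k + 1)).2⟩
    have hsub : V k ∩ D ⊆ ball b (ρ k) ∩ D := inter_subset_inter_left _ (hVρ k)
    have hcomp := (hVD k).isPreconnected.subset_connectedComponentIn hxk hsub
    have hpath := ((isOpen_ball.inter hD).connectedComponentIn (x := x k)
      |>.isConnected_iff_isPathConnected).1 (isConnected_connectedComponentIn_iff.2 (hsub hxk))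
    exact (hpath.joinedIn _ (hcomp hxk) _ (hcomp hxk')).mono (connectedComponentIn_subset _ _)
  obtain ⟨f, hf, hfp⟩ := exists_continuous_concat fun k => (hjoin k).somePath
  have hfmem : ∀ t, f t ∈ ball b (ρ ⌊t⌋₊) ∩ D := by
    intro t
    obtain ⟨u, hu⟩ := hfp t
    exact hu ▸ (hjoin _).somePath_mem u
  have hρlim : Tendsto ρ atTop (𝓝 0) := by
    simpa [ρ, div_eq_mul_inv] using (tendsto_one_div_add_atTop_nhds_zero_nat (𝕜 := ℝ)).const_mul r
  have hflim : Tendsto f atTop (𝓝 b) := by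
    rw [tendsto_iff_dist_tendsto_zero]
    exact squeeze_zero (fun _ => dist_nonneg) (fun t => (mem_ball.1 (hfmem t).1).le)
      (hρlim.comp (tendsto_nat_floor_atTop (α := ℝ)))
  let β : ℝ → EuclideanSpace ℝ (Fin n) := Function.update (fun t => f (1 - t)⁻¹) 1 b
  have hβ : ∀ t ≠ 1, β t = f (1 - t)⁻¹ := fun t ht => Function.update_of_ne ht _ _
  refine ⟨β, fun t ht => ?_, Function.update_self _ _ _, fun t ht => ?_⟩
  · rcases eq_or_ne t 1 with rfl | hne
    · rw [continuousWithinAt_update_same]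
      refine hflim.comp (tendsto_inv_nhdsGT_zero.comp ?_)
      refine tendsto_nhdsWithin_iff.2 ⟨?_, ?_⟩
      · have : Tendsto (fun t : ℝ => 1 - t) (𝓝 1) (𝓝 (1 - 1)) :=
          (continuous_const.sub continuous_id).tendsto 1
        rw [sub_self] at this
        exact this.mono_left nhdsWithin_le_nhds
      · filter_upwards [self_mem_nhdsWithin] with t ht
        exact sub_pos.2 (lt_of_le_of_ne ht.1.2 ht.2)
    · refine ContinuousAt.continuousWithinAt ((continuousAt_update_of_ne hne).2 ?_)
      exact hf.continuousAt.comp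
        ((continuousAt_const.sub continuousAt_id).inv₀ (sub_ne_zero.2 hne.symm))
  · rw [hβ t ht.2.ne]
    refine ⟨hrU (ball_subset_ball ?_ (hfmem _).1), (hfmem _).2⟩
    exact div_le_self hr.le (by simp)

/-- Every point of a nonempty open set is reached by a nondegenerate path in that set. -/
theorem IsOpen.exists_access_path {E : Type*} [NormedAddCommGroup E] [NormedSpace ℝ E]
    [Nontrivial E] {s : Set E} (hs : IsOpen s) {b : E} (hb : b ∈ s) :
    ∃ β : ℝ → E, ContinuousOn β (Icc 0 1) ∧ β 1 = b ∧ β 0 ≠ b ∧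
      ∀ t ∈ Icc (0 : ℝ) 1, β t ∈ s := by
  obtain ⟨r, hr, hrs⟩ := Metric.isOpen_iff.1 hs b hb
  obtain ⟨v, hv⟩ := exists_norm_eq E (half_pos hr).le
  refine ⟨fun t => b + (1 - t) • v, by fun_prop, by simp, ?_, fun t ht => hrs ?_⟩
  · have : v ≠ 0 := norm_pos_iff.1 (hv ▸ half_pos hr)
    simpa using this
  · rw [mem_ball, dist_self_add_left, norm_smul, hv, Real.norm_eq_abs,
      abs_of_nonneg (sub_nonneg.2 ht.2)]
    nlinarith [ht.1, ht.2]

/-- A domain locally connected at its boundary admits nondegenerate access paths to every point of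
its closure. -/
theorem exists_access_path_of_mem_closure {n : ℕ} (hn : 2 ≤ n)
    {D : Set (EuclideanSpace ℝ (Fin n))} (hD : IsOpen D)
    (hlc : ∀ x₀ ∈ frontier D, LocallyConnectedAtBoundaryPoint D x₀)
    {b : EuclideanSpace ℝ (Fin n)} (hb : b ∈ closure D)
    {U : Set (EuclideanSpace ℝ (Fin n))} (hU : U ∈ 𝓝 b) :
    ∃ β : ℝ → EuclideanSpace ℝ (Fin n), ContinuousOn β (Icc 0 1) ∧ β 1 = b ∧ β 0 ≠ b ∧
      ∀ t ∈ Ico (0 : ℝ) 1, β t ∈ U ∩ D := by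
  by_cases hbD : b ∈ D
  · have : Nonempty (Fin n) := ⟨⟨0, by omega⟩⟩
    obtain ⟨β, hβ, hβ1, hβ0, hmem⟩ := (isOpen_interior.inter hD).exists_access_path
      (⟨mem_interior_iff_mem_nhds.2 hU, hbD⟩ : b ∈ interior U ∩ D)
    exact ⟨β, hβ, hβ1, hβ0, fun t ht =>
      ⟨interior_subset (hmem t ⟨ht.1, ht.2.le⟩).1, (hmem t ⟨ht.1, ht.2.le⟩).2⟩⟩
  · have hfr : b ∈ frontier D := hD.frontier_eq ▸ ⟨hb, hbD⟩
    obtain ⟨β, hβ, hβ1, hmem⟩ := (hlc b hfr).exists_access_path hD hb hU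
    exact ⟨β, hβ, hβ1, fun h => hbD (h ▸ (hmem 0 (by simp)).2), hmem⟩

theorem disjoint_paths_in_locally_connected_domain {n : ℕ} (hn : 2 ≤ n)
    (D : Set (EuclideanSpace ℝ (Fin n))) (hD : IsOpen D) (hDc : IsConnected D)
    (hDb : Bornology.IsBounded D)
    (hlc : ∀ x₀ ∈ frontier D, LocallyConnectedAtBoundaryPoint D x₀)
    (a c : EuclideanSpace ℝ (Fin n)) (b d : EuclideanSpace ℝ (Fin n))
    (ha : a ∈ D) (hb : b ∈ closure D) (hc : c ∈ D) (hd : d ∈ closure D)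
    (hab : a ≠ b) (hcd : c ≠ d)
    (hdisj : ({a, b} ∩ {c, d} : Set (EuclideanSpace ℝ (Fin n))) = ∅) :
    ∃ γ₁ γ₂ : ℝ → EuclideanSpace ℝ (Fin n),
      ContinuousOn γ₁ (Icc 0 1) ∧ ContinuousOn γ₂ (Icc 0 1) ∧
      (γ₁ '' Icc 0 1) ⊆ closure D ∧ (γ₂ '' Icc 0 1) ⊆ closure D ∧
      (γ₁ '' Icc 0 1) ∩ (γ₂ '' Icc 0 1) = ∅ ∧
      (∀ t ∈ Ioo (0:ℝ) 1, γ₁ t ∈ D) ∧ (∀ t ∈ Ioo (0:ℝ) 1, γ₂ t ∈ D) ∧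
      γ₁ 0 = a ∧ γ₁ 1 = b ∧ γ₂ 0 = c ∧ γ₂ 1 = d := by
  have hrank : 1 < Module.rank ℝ (EuclideanSpace ℝ (Fin n)) := by
    rw [← Module.finrank_eq_rank, finrank_euclideanSpace_fin]
    exact_mod_cast hn
  have hne : a ≠ c ∧ a ≠ d ∧ b ≠ c ∧ b ≠ d := by
    refine ⟨?_, ?_, ?_, ?_⟩ <;> rintro rfl
    · exact (hdisj ▸ notMem_empty a) ⟨by simp, by simp⟩
    · exact (hdisj ▸ notMem_empty a) ⟨by simp, by simp⟩
    · exact (hdisj ▸ notMem_empty b) ⟨by simp, by simp⟩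
    · exact (hdisj ▸ notMem_empty b) ⟨by simp, by simp⟩
  obtain ⟨hac, had, hbc, hbd⟩ := hne
  obtain ⟨U, W, hU, hW, hbU, hdW, hUW⟩ := t2_separation hbd
  obtain ⟨β, hβ, hβ1, hβ0, hβmem⟩ := exists_access_path_of_mem_closure hn hD hlc hb
    (hU.mem_nhds hbU)
  obtain ⟨δ, hδ, hδ1, hδ0, hδmem⟩ := exists_access_path_of_mem_closure hn hD hlc hd
    (inter_mem (hW.mem_nhds hdW) (isOpen_ne.mem_nhds had.symm))
  have hβU : ∀ t ∈ Icc (0 : ℝ) 1, β t ∈ U := fun t ht =>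
    ht.2.lt_or_eq.elim (fun h => (hβmem t ⟨ht.1, h⟩).1) fun h => h ▸ hβ1 ▸ hbU
  have hδW : ∀ t ∈ Icc (0 : ℝ) 1, δ t ∈ W := fun t ht =>
    ht.2.lt_or_eq.elim (fun h => (hδmem t ⟨ht.1, h⟩).1.1) fun h => h ▸ hδ1 ▸ hdW
  have h0 : (0 : ℝ) ∈ Ico (0 : ℝ) 1 := by simp
  have h0' : (0 : ℝ) ∈ Icc (0 : ℝ) 1 := by simp
  have hopen : ∀ p q r, IsOpen (((D \ {p}) \ {q}) \ {r}) := fun p q r =>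
    ((hD.sdiff isClosed_singleton).sdiff isClosed_singleton).sdiff isClosed_singleton
  have hconn : ∀ p q r, IsPreconnected (((D \ {p}) \ {q}) \ {r}) := fun p q r =>
    ((hDc.isPreconnected.diff_singleton_of_one_lt_rank hrank hD p).diff_singleton_of_one_lt_rank
      hrank (hD.sdiff isClosed_singleton) q).diff_singleton_of_one_lt_rank hrank
        ((hD.sdiff isClosed_singleton).sdiff isClosed_singleton) r
  obtain ⟨g, hga, hg⟩ := (hconn b d (δ 0)).exists_homeomorph_apply_eq (hopen b d (δ 0))
    (x := β 0) (y := a)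
    ⟨⟨⟨(hβmem 0 h0).2, hβ0⟩, hUW.ne_of_mem (hβU 0 h0') hdW⟩,
      hUW.ne_of_mem (hβU 0 h0') (hδW 0 h0')⟩
    ⟨⟨⟨ha, hab⟩, had⟩, (hδmem 0 h0).1.2.symm⟩
  obtain ⟨k, hkc, hk⟩ := (hconn b d a).exists_homeomorph_apply_eq (hopen b d a)
    (x := δ 0) (y := c)
    ⟨⟨⟨(hδmem 0 h0).2, (hUW.ne_of_mem hbU (hδW 0 h0')).symm⟩, hδ0⟩, (hδmem 0 h0).1.2⟩
    ⟨⟨⟨hc, hbc.symm⟩, hcd⟩, hac.symm⟩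
  let h := g.trans k
  have hfix : ∀ z, z ∉ D ∨ z = b ∨ z = d → h z = z := by
    intro z hz
    have hgz : g z = z := hg z (by simp only [Set.mem_sdiff, mem_singleton_iff]; tauto)
    have hkz : k z = z := hk z (by simp only [Set.mem_sdiff, mem_singleton_iff]; tauto)
    simp [h, hgz, hkz]
  have hmapsTo : ∀ z ∈ D, h z ∈ D := by
    intro z hz
    by_contra hnot
    exact hnot ((h.injective (hfix _ (Or.inl hnot))).symm ▸ hz)
  have hhβ : ∀ t ∈ Ico (0 : ℝ) 1, h (β t) ∈ D := fun t ht => hmapsTo _ (hβmem t ht).2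
  have hhδ : ∀ t ∈ Ico (0 : ℝ) 1, h (δ t) ∈ D := fun t ht => hmapsTo _ (hδmem t ht).2
  have hβ1' : h (β 1) = b := by rw [hβ1]; exact hfix b (by simp)
  have hδ1' : h (δ 1) = d := by rw [hδ1]; exact hfix d (by simp)
  refine ⟨fun t => h (β t), fun t => h (δ t), h.continuous.comp_continuousOn hβ,
    h.continuous.comp_continuousOn hδ, ?_, ?_, ?_, fun t ht => hhβ t ⟨ht.1.le, ht.2⟩,
    fun t ht => hhδ t ⟨ht.1.le, ht.2⟩, ?_, hβ1', ?_, hδ1'⟩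
  · rintro _ ⟨t, ht, rfl⟩
    rcases ht.2.lt_or_eq with hlt | rfl
    · exact subset_closure (hhβ t ⟨ht.1, hlt⟩)
    · simpa only [hβ1'] using hb
  · rintro _ ⟨t, ht, rfl⟩
    rcases ht.2.lt_or_eq with hlt | rfl
    · exact subset_closure (hhδ t ⟨ht.1, hlt⟩)
    · simpa only [hδ1'] using hd
  · refine eq_empty_of_forall_notMem ?_
    rintro _ ⟨⟨t, ht, rfl⟩, u, hu, hut⟩
    exact hUW.ne_of_mem (hβU t ht) (hδW u hu) (h.injective hut).symm
  · simp only [h, Homeomorph.trans_apply, hga]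
    exact hk a (by simp)
  · have : g (δ 0) = δ 0 := hg _ (by simp)
    simp only [h, Homeomorph.trans_apply, this, hkc]
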